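/- Let C := {(x,y) ∈ ℝ² : x < 0 and y < 0} ∪ {(x,y) ∈ ℝ² : 1 ≤ x ≤ 2 and y ≤ 0}. There do not exist real polynomials p, q ∈ ℝ[x,y] satisfying all three of the following conditions: (i) p(z) ≠ 0 and q(z) ≠ 0 for every point z ∈ C; (ii) p(x,0) = x·q(x,0) for every x ∈ [1,2]; (iii) p(−1,−1)·q(−1,−1) > 0. -/

import Mathlib

open MvPolynomial

/-- Restricting a bivariate polynomial to the first axis gives a univariate polynomial. -/
theorem eval_aeval_X_zero (p : MvPolynomial (Fin 2) ℝ) (x : ℝ) :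
    (aeval ![(Polynomial.X : Polynomial ℝ), 0] p).eval x = eval ![x, 0] p := by
  induction p using MvPolynomial.induction_on with
  | C a => simp [Polynomial.algebraMap_eq]
  | add p q hp hq => simp [hp, hq]
  | mul_X p i hp => fin_cases i <;> simp [hp]

/-- If `p(x,0) = x·q(x,0)` on `[1,2]` and `q(1,0) ≠ 0`, then `p·q` is negative somewhere on the
negative part of the first axis. -/
theorem exists_neg_eval_mul_eval_neg (p q : MvPolynomial (Fin 2) ℝ)
    (hpq : ∀ x ∈ Set.Icc (1 : ℝ) 2, eval ![x, 0] p = x * eval ![x, 0] q)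
    (hq : eval ![(1 : ℝ), 0] q ≠ 0) :
    ∃ x < 0, eval ![x, 0] p * eval ![x, 0] q < 0 := by
  have heq : aeval ![(Polynomial.X : Polynomial ℝ), 0] p =
      Polynomial.X * aeval ![(Polynomial.X : Polynomial ℝ), 0] q := by
    refine Polynomial.eq_of_infinite_eval_eq _ _
      ((Set.Icc_infinite (by norm_num : (1 : ℝ) < 2)).mono fun x hx => ?_)
    simpa [eval_aeval_X_zero] using hpq x hx
  obtain ⟨x, hx, hqx⟩ : ∃ x < 0, eval ![x, 0] q ≠ 0 := by
    by_contra! h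
    have hzero : aeval ![(Polynomial.X : Polynomial ℝ), 0] q = 0 := by
      refine Polynomial.eq_of_infinite_eval_eq _ _
        ((Set.Iio_infinite (0 : ℝ)).mono fun x hx => ?_)
      simpa [eval_aeval_X_zero] using h x hx
    exact hq (by simpa [hzero] using (eval_aeval_X_zero q 1).symm)
  refine ⟨x, hx, ?_⟩
  have hpx : eval ![x, 0] p = x * eval ![x, 0] q := by
    simpa [eval_aeval_X_zero] using congrArg (Polynomial.eval x) heq
  rw [hpx, mul_assoc]
  exact mul_neg_of_neg_of_pos hx (mul_self_pos.mpr hqx)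




/-- No pair of real polynomials `p, q` in two variables can simultaneously be nonvanishing
on the (non-closed) set `C = {x < 0, y < 0} ∪ {1 ≤ x ≤ 2, y ≤ 0}`, satisfy
`p(x,0) = x·q(x,0)` for `x ∈ [1,2]`, and have `p·q > 0` at `(-1,-1)`. -/
theorem no_regular_approximation :
    ¬ ∃ p q : MvPolynomial (Fin 2) ℝ,
      (∀ z : ℝ × ℝ,
        z ∈ ({z : ℝ × ℝ | z.1 < 0 ∧ z.2 < 0} ∪
             {z : ℝ × ℝ | 1 ≤ z.1 ∧ z.1 ≤ 2 ∧ z.2 ≤ 0}) →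
        eval ![z.1, z.2] p ≠ 0 ∧ eval ![z.1, z.2] q ≠ 0) ∧
      (∀ x ∈ Set.Icc (1 : ℝ) 2, eval ![x, 0] p = x * eval ![x, 0] q) ∧
      0 < eval ![(-1 : ℝ), -1] p * eval ![(-1 : ℝ), -1] q := by
  rintro ⟨p, q, hne, hpq, hpos⟩
  obtain ⟨x, hx, hneg⟩ := exists_neg_eval_mul_eval_neg p q hpq
    (hne (1, 0) (Or.inr (by norm_num))).2
  let γ : ℝ → Fin 2 → ℝ := fun t => ![-1 + t * (x + 1), -1 + t]
  have hγ : Continuous γ := by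
    refine continuous_pi fun i => ?_
    fin_cases i <;> simp only [γ] <;> dsimp <;> fun_prop
  have hcont : Continuous fun t => eval (γ t) p * eval (γ t) q :=
    ((continuous_eval p).comp hγ).mul ((continuous_eval q).comp hγ)
  obtain ⟨t, ⟨ht0, ht1⟩, ht⟩ :=
    intermediate_value_Ioo' zero_le_one hcont.continuousOn
      (show (0 : ℝ) ∈ Set.Ioo _ _ from ⟨by simpa [γ] using hneg, by simpa [γ] using hpos⟩)
  have hmem := hne (-1 + t * (x + 1), -1 + t)
    (Or.inl ⟨by dsimp only; nlinarith, by dsimp only; linarith⟩)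
  exact mul_ne_zero hmem.1 hmem.2 ht
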